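/- For every acceptance mode (σ,ρ) with σ ∈ {ran, inf} and ρ ∈ {⊓, ⊆, =}, 𝓛_{σ,ρ,nl}(ω-RLG) = 𝓛_{σ,ρ,l}(ω-RLG) = 𝓛_{σ,ρ}(ω-FSA), i.e., for right linear ω-grammars normal and leftmost derivations yield the same family of ω-languages, and this family equals the one (σ,ρ)-accepted by finite state ω-automata. -/

import Mathlib

namespace OmegaFormal

/-- σ component of an acceptance mode: `ran` (occurs at least once)
or `inf` (occurs infinitely often). -/
inductive AccSigma | ran | inf
deriving DecidableEq

/-- ρ component of an acceptance mode: `cap` (nonempty intersection, ⊓),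
`sub` (⊆) or `eq` (=). -/
inductive AccRho | cap | sub | eq
deriving DecidableEq

/-- derivation mode: leftmost (`l`) or normal (`nl`). -/
inductive DerivMode | l | nl
deriving DecidableEq

/-- `sigmaSet σ f` is ran(f) resp. inf(f). -/
def sigmaSet {Q : Type _} : AccSigma → (ℕ → Q) → Set Q
  | .ran, f => Set.range f
  | .inf, f => {q | ∀ n : ℕ, ∃ m : ℕ, n ≤ m ∧ f m = q}

/-- the binary relation denoted by ρ. -/
def rhoRel {Q : Type _} : AccRho → Set Q → Set Q → Prop
  | .cap, A, B => (A ∩ B).Nonempty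
  | .sub, A, B => A ⊆ B
  | .eq,  A, B => A = B

/-- f is (σ,ρ)-accepting w.r.t. the set 𝓕 of designated sets. -/
def IsAccepting {Q : Type _} (σ : AccSigma) (ρ : AccRho) (𝓕 : Set (Set Q)) (f : ℕ → Q) : Prop :=
  ∃ F ∈ 𝓕, rhoRel ρ (sigmaSet σ f) F

/-- the finite word `l` coincides with the prefix of the ω-word `u`. -/
def MatchesPrefix {T : Type _} (l : List T) (u : ℕ → T) : Prop :=
  ∀ (k : ℕ) (h : k < l.length), l.get ⟨k, h⟩ = u k

/-- the maximal terminal prefix of a sentential form. -/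
def termPrefix {N T : Type _} : List (N ⊕ T) → List T
  | [] => []
  | (Sum.inl _) :: _ => []
  | (Sum.inr a) :: l => a :: termPrefix l

/-- A phrase structure ω-grammar `G = (N, T, P, S, 𝓕)`:
`N` nonterminals, `T` terminals, `P` named productions `p : lhs p → rhs p`
with `lhs p ∈ N⁺`, `rhs p ∈ (N ∪ T)*`, start symbol, and
production repetition sets `acc ⊆ 2^P`. -/
structure OmegaPSG (T : Type) where
  N : Type
  [fintypeN : Fintype N]
  P : Type
  [fintypeP : Fintype P]
  lhs : P → List N
  lhs_ne : ∀ p : P, lhs p ≠ []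
  rhs : P → List (N ⊕ T)
  start : N
  acc : Set (Set P)

namespace OmegaPSG

variable {T : Type} (G : OmegaPSG T)

/-- one (normal) rewriting step using production p. -/
def Step (p : G.P) (x y : List (G.N ⊕ T)) : Prop :=
  ∃ u v : List (G.N ⊕ T),
    x = u ++ (G.lhs p).map Sum.inl ++ v ∧ y = u ++ G.rhs p ++ v

/-- one leftmost rewriting step: the rewritten occurrence starts at the
leftmost nonterminal, i.e. everything to its left is terminal. -/
def LStep (p : G.P) (x y : List (G.N ⊕ T)) : Prop :=
  ∃ u v : List (G.N ⊕ T), (∀ s ∈ u, ∃ a : T, s = Sum.inr a) ∧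
    x = u ++ (G.lhs p).map Sum.inl ++ v ∧ y = u ++ G.rhs p ++ v

def StepOf : DerivMode → G.P → List (G.N ⊕ T) → List (G.N ⊕ T) → Prop
  | .l => G.LStep
  | .nl => G.Step

/-- `L_{σ,ρ,π}(G)`: ω-words admitting an infinite π-derivation from S whose
growing terminal prefixes spell the word and whose production sequence is
(σ,ρ)-accepting w.r.t. `G.acc`. -/
def Lang (σ : AccSigma) (ρ : AccRho) (π : DerivMode) : Set (ℕ → T) :=
  {u | ∃ (s : ℕ → List (G.N ⊕ T)) (d : ℕ → G.P),
    s 0 = [Sum.inl G.start] ∧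
    (∀ i : ℕ, G.StepOf π (d i) (s i) (s (i + 1))) ∧
    (∀ n : ℕ, ∃ i : ℕ, n ≤ (termPrefix (s i)).length) ∧
    (∀ i : ℕ, MatchesPrefix (termPrefix (s i)) u) ∧
    IsAccepting σ ρ G.acc d}

/-- context-free: every left-hand side is a single nonterminal. -/
def IsCFG : Prop := ∀ p : G.P, (G.lhs p).length = 1

/-- context-sensitive (monotonic): `|β| ≥ |α|` for every production. -/
def IsCSG : Prop := ∀ p : G.P, (G.lhs p).length ≤ (G.rhs p).length

/-- right linear: productions of the form `A → uB` or `A → u`, `u ∈ T*`. -/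
def IsRLG : Prop :=
  ∀ p : G.P, (G.lhs p).length = 1 ∧
    ∃ (w : List T) (B : Option G.N),
      G.rhs p = w.map Sum.inr ++ B.toList.map Sum.inl

/-- `G` is a grammar with `$`-boundary (PSG version): with `$` = `dollar`,
`S` = `S'`, every production has one of the forms
(1) α → β, α,β ∈ N⁺ (N = nonterminals other than `$`, `S`),
(2) S → $α, α ∈ N⁺, (3) $A → a$, (4) A → ε. -/
def HasDollarBoundary (dollar S' : G.N) : Prop :=
  dollar ≠ S' ∧ G.start = S' ∧
  ∀ p : G.P,
    ((dollar ∉ G.lhs p ∧ S' ∉ G.lhs p) ∧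
      ∃ β : List G.N, β ≠ [] ∧ dollar ∉ β ∧ S' ∉ β ∧ G.rhs p = β.map Sum.inl) ∨
    (G.lhs p = [S'] ∧ ∃ α : List G.N, α ≠ [] ∧ dollar ∉ α ∧ S' ∉ α ∧
      G.rhs p = Sum.inl dollar :: α.map Sum.inl) ∨
    (∃ A : G.N, A ≠ dollar ∧ A ≠ S' ∧ G.lhs p = [dollar, A] ∧
      ∃ a : T, G.rhs p = [Sum.inr a, Sum.inl dollar]) ∨
    (∃ A : G.N, A ≠ dollar ∧ A ≠ S' ∧ G.lhs p = [A] ∧ G.rhs p = [])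

/-- `G` is a grammar with `$`-boundary (CSG version): forms (1)-(3) only,
with `|α| ≤ |β|` in form (1). -/
def HasDollarBoundaryCSG (dollar S' : G.N) : Prop :=
  dollar ≠ S' ∧ G.start = S' ∧
  ∀ p : G.P,
    ((dollar ∉ G.lhs p ∧ S' ∉ G.lhs p) ∧
      ∃ β : List G.N, β ≠ [] ∧ dollar ∉ β ∧ S' ∉ β ∧ (G.lhs p).length ≤ β.length ∧
        G.rhs p = β.map Sum.inl) ∨
    (G.lhs p = [S'] ∧ ∃ α : List G.N, α ≠ [] ∧ dollar ∉ α ∧ S' ∉ α ∧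
      G.rhs p = Sum.inl dollar :: α.map Sum.inl) ∨
    (∃ A : G.N, A ≠ dollar ∧ A ≠ S' ∧ G.lhs p = [dollar, A] ∧
      ∃ a : T, G.rhs p = [Sum.inr a, Sum.inl dollar])

end OmegaPSG

/-- `𝓛_{σ,ρ,π}(X)` for the family `X` of ω-grammars over `T` satisfying `C`. -/
def GLang (T : Type) (C : OmegaPSG T → Prop) (σ : AccSigma) (ρ : AccRho) (π : DerivMode) :
    Set (Set (ℕ → T)) :=
  {L | ∃ G : OmegaPSG T, C G ∧ L = G.Lang σ ρ π}

/-- number of non-ε labels among `b 0, …, b (i-1)`. -/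
def someCount {A : Type _} (b : ℕ → Option A) (i : ℕ) : ℕ :=
  ((Finset.range i).filter fun j => (b j).isSome = true).card

/-- the (ε-allowing) label sequence `b` concatenates to the ω-word `u`. -/
def Spells {A : Type _} (b : ℕ → Option A) (u : ℕ → A) : Prop :=
  (∀ n : ℕ, ∃ i : ℕ, n ≤ someCount b i) ∧
  ∀ i : ℕ, ∀ a : A, b i = some a → a = u (someCount b i)

/-- A finite state ω-automaton `(Q, Σ, δ, q₀, 𝓕)`. -/
structure OmegaFSA (Sig : Type) where
  Q : Type
  [fintypeQ : Fintype Q]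
  init : Q
  trans : Q → Option Sig → Q → Prop
  acc : Set (Set Q)

/-- `L_{σ,ρ}(A)` for a finite state ω-automaton. -/
def OmegaFSA.Lang {Sig : Type} (A : OmegaFSA Sig) (σ : AccSigma) (ρ : AccRho) :
    Set (ℕ → Sig) :=
  {u | ∃ (r : ℕ → A.Q) (b : ℕ → Option Sig),
    r 0 = A.init ∧ (∀ i : ℕ, A.trans (r i) (b i) (r (i + 1))) ∧
    Spells b u ∧ IsAccepting σ ρ A.acc r}

/-- `𝓛_{σ,ρ}(ω-FSA)`. -/
def FSALang (Sig : Type) (σ : AccSigma) (ρ : AccRho) : Set (Set (ℕ → Sig)) :=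
  {L | ∃ A : OmegaFSA Sig, L = A.Lang σ ρ}

/-- A pushdown ω-automaton `(Q, Σ, Γ, δ, q₀, Z₀, 𝓕)`. -/
structure OmegaPDA (Sig : Type) where
  Q : Type
  [fintypeQ : Fintype Q]
  Γ : Type
  [fintypeΓ : Fintype Γ]
  init : Q
  Z0 : Γ
  trans : Q → Option Sig → Γ → Q → List Γ → Prop
  acc : Set (Set Q)

/-- `L_{σ,ρ}(D)` for a pushdown ω-automaton. -/
def OmegaPDA.Lang {Sig : Type} (D : OmegaPDA Sig) (σ : AccSigma) (ρ : AccRho) :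
    Set (ℕ → Sig) :=
  {u | ∃ (q : ℕ → D.Q) (st : ℕ → List D.Γ) (b : ℕ → Option Sig),
    q 0 = D.init ∧ st 0 = [D.Z0] ∧
    (∀ i : ℕ, ∃ (Z : D.Γ) (γ rest : List D.Γ),
      st i = Z :: rest ∧ D.trans (q i) (b i) Z (q (i + 1)) γ ∧ st (i + 1) = γ ++ rest) ∧
    Spells b u ∧ IsAccepting σ ρ D.acc q}

/-- `𝓛_{σ,ρ}(ω-PDA)`. -/
def PDALang (Sig : Type) (σ : AccSigma) (ρ : AccRho) : Set (Set (ℕ → Sig)) :=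
  {L | ∃ D : OmegaPDA Sig, L = D.Lang σ ρ}

/-- tape head moves. -/
inductive Move | L | R | S
deriving DecidableEq

def moveHead : Move → ℕ → ℕ
  | .L, n => n - 1
  | .R, n => n + 1
  | .S, n => n

/-- A single-tape Turing ω-machine `(Q, Σ, Γ, δ, q₀, 𝓕)` (Σ ⊆ Γ via `embed`). -/
structure OmegaTM (Sig : Type) where
  Q : Type
  [fintypeQ : Fintype Q]
  Γ : Type
  [fintypeΓ : Fintype Γ]
  embed : Sig → Γ
  embed_inj : Function.Injective embed
  init : Q
  trans : Q → Γ → Q → Γ → Move → Prop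
  acc : Set (Set Q)

/-- `L_{σ,ρ}(M)`: ω-words admitting a complete non-oscillating run whose state
sequence is (σ,ρ)-accepting. -/
def OmegaTM.Lang {Sig : Type} (M : OmegaTM Sig) (σ : AccSigma) (ρ : AccRho) :
    Set (ℕ → Sig) :=
  {u | ∃ (q : ℕ → M.Q) (tape : ℕ → ℕ → M.Γ) (pos : ℕ → ℕ),
    q 0 = M.init ∧ (∀ n : ℕ, tape 0 n = M.embed (u n)) ∧ pos 0 = 0 ∧
    (∀ i : ℕ, ∃ (g : M.Γ) (m : Move),
      M.trans (q i) (tape i (pos i)) (q (i + 1)) g m ∧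
      tape (i + 1) = Function.update (tape i) (pos i) g ∧
      pos (i + 1) = moveHead m (pos i)) ∧
    (∀ n : ℕ, ∃ i : ℕ, n ≤ pos i) ∧
    (∀ n : ℕ, ∃ i0 : ℕ, ∀ i : ℕ, i0 ≤ i → pos i ≠ n) ∧
    IsAccepting σ ρ M.acc q}

/-- `𝓛_{σ,ρ}(ω-TM)`. -/
def TMLang (Sig : Type) (σ : AccSigma) (ρ : AccRho) : Set (Set (ℕ → Sig)) :=
  {L | ∃ M : OmegaTM Sig, L = M.Lang σ ρ}

/-- An m-tape Turing ω-machine. -/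
structure OmegaMTM (m : ℕ) (Sig : Type) where
  Q : Type
  [fintypeQ : Fintype Q]
  Γ : Type
  [fintypeΓ : Fintype Γ]
  embed : Sig → Γ
  embed_inj : Function.Injective embed
  blank : Γ
  init : Q
  trans : Q → (Fin m → Γ) → Q → (Fin m → Γ) → (Fin m → Move) → Prop
  acc : Set (Set Q)

/-- `L_{σ,ρ}(M)` for an m-tape Turing ω-machine (`hm : 0 < m`; the input is on
the first tape, the other tapes are initially blank; the run must be complete
and non-oscillating on the first tape). -/
def OmegaMTM.Lang {m : ℕ} {Sig : Type} (M : OmegaMTM m Sig) (hm : 0 < m)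
    (σ : AccSigma) (ρ : AccRho) : Set (ℕ → Sig) :=
  {u | ∃ (q : ℕ → M.Q) (tape : ℕ → Fin m → ℕ → M.Γ) (pos : ℕ → Fin m → ℕ),
    q 0 = M.init ∧
    (∀ n : ℕ, tape 0 ⟨0, hm⟩ n = M.embed (u n)) ∧
    (∀ j : Fin m, j ≠ ⟨0, hm⟩ → ∀ n : ℕ, tape 0 j n = M.blank) ∧
    (∀ j : Fin m, pos 0 j = 0) ∧
    (∀ i : ℕ, ∃ (g : Fin m → M.Γ) (mv : Fin m → Move),
      M.trans (q i) (fun j => tape i j (pos i j)) (q (i + 1)) g mv ∧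
      (∀ j : Fin m, tape (i + 1) j = Function.update (tape i j) (pos i j) (g j)) ∧
      (∀ j : Fin m, pos (i + 1) j = moveHead (mv j) (pos i j))) ∧
    (∀ n : ℕ, ∃ i : ℕ, n ≤ pos i ⟨0, hm⟩) ∧
    (∀ n : ℕ, ∃ i0 : ℕ, ∀ i : ℕ, i0 ≤ i → pos i ⟨0, hm⟩ ≠ n) ∧
    IsAccepting σ ρ M.acc q}

/-- `𝓛_{σ,ρ}(m-ω-TM)`. -/
def MTMLang (Sig : Type) (m : ℕ) (hm : 0 < m) (σ : AccSigma) (ρ : AccRho) :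
    Set (Set (ℕ → Sig)) :=
  {L | ∃ M : OmegaMTM m Sig, L = M.Lang hm σ ρ}

/-- the ω-language `{aⁿbⁿ | n ≥ 1}^ω` over the alphabet `Bool`
(`false` = a, `true` = b). -/
def abLang : Set (ℕ → Bool) :=
  {u | ∃ n : ℕ → ℕ, (∀ i : ℕ, 1 ≤ n i) ∧
    ∀ i k : ℕ, k < 2 * n i →
      u ((∑ j ∈ Finset.range i, 2 * n j) + k) = decide (n i ≤ k)}

end OmegaFormal
open OmegaFormal

namespace OmegaFormal

section Concat

variable {P T : Type}

/-- the concatenation of the words `w (d 0), …, w (d (i - 1))`. -/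
def concatUpTo (w : P → List T) (d : ℕ → P) : ℕ → List T
  | 0 => []
  | i + 1 => concatUpTo w d i ++ w (d i)

/-- the words `w (d 0), w (d 1), …` concatenate to the ω-word `u`. -/
def ConcatsTo (w : P → List T) (d : ℕ → P) (u : ℕ → T) : Prop :=
  (∀ n : ℕ, ∃ i : ℕ, n ≤ (concatUpTo w d i).length) ∧
  ∀ i : ℕ, MatchesPrefix (concatUpTo w d i) u

theorem MatchesPrefix.of_isPrefix {l l' : List T} {u : ℕ → T} (h : MatchesPrefix l' u)
    (hl : l <+: l') : MatchesPrefix l u := by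
  intro k hk
  have := h k (hk.trans_le hl.length_le)
  rw [← this]
  simpa using hl.getElem hk

theorem matchesPrefix_append_toList (l : List T) (o : Option T) (u : ℕ → T) :
    MatchesPrefix (l ++ o.toList) u ↔
      MatchesPrefix l u ∧ ∀ a, o = some a → a = u l.length := by
  constructor
  · intro h
    refine ⟨h.of_isPrefix (List.prefix_append _ _), ?_⟩
    rintro a rfl
    simpa using h l.length (by simp)
  · rintro ⟨h, ho⟩ k hk
    by_cases hkl : k < l.length
    · simpa [List.getElem_append_left hkl] using h k hkl
    · cases o with
      | none => simp at hk; omega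
      | some a =>
        have : k = l.length := by simp at hk; omega
        subst this
        simpa using ho a rfl

theorem length_concatUpTo_toList (b : ℕ → Option T) (i : ℕ) :
    (concatUpTo Option.toList b i).length = someCount b i := by
  induction i with
  | zero => simp [concatUpTo, someCount]
  | succ i ih =>
    simp only [concatUpTo, List.length_append, ih, someCount, Finset.range_add_one,
      Finset.filter_insert]
    cases h : b i <;> simp

theorem spells_iff_concatsTo (b : ℕ → Option T) (u : ℕ → T) :
    Spells b u ↔ ConcatsTo Option.toList b u := by
  simp only [Spells, ConcatsTo, length_concatUpTo_toList]
  refine and_congr_right fun _ => ⟨fun h i => ?_, fun h i a ha => ?_⟩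
  · induction i with
    | zero => intro k hk; simp [concatUpTo] at hk
    | succ i ih =>
      rw [concatUpTo, matchesPrefix_append_toList, length_concatUpTo_toList]
      exact ⟨ih, h i⟩
  · have := h (i + 1)
    rw [concatUpTo, matchesPrefix_append_toList, length_concatUpTo_toList] at this
    exact this.2 a ha

theorem concatUpTo_comp {R : Type} (w : P → List T) (f : R → P) (d : ℕ → R) (i : ℕ) :
    concatUpTo w (fun k => f (d k)) i = concatUpTo (fun x => w (f x)) d i := by
  induction i with
  | zero => rfl
  | succ i ih => simp [concatUpTo, ih]

end Concat

section RightLinear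

variable {T N P : Type}

/-- `d` is a sequence of right linear productions `lh p → w p · nx p` that can be applied one
after the other, starting from the nonterminal `S`, and that generates the ω-word `u`. -/
def IsProductionRun (w : P → List T) (lh : P → N) (nx : P → Option N) (S : N)
    (d : ℕ → P) (u : ℕ → T) : Prop :=
  lh (d 0) = S ∧ (∀ i, nx (d i) = some (lh (d (i + 1)))) ∧ ConcatsTo w d u

/-- the sentential form consisting of a terminal word and at most one final nonterminal. -/
def rlForm (w : List T) (B : Option N) : List (N ⊕ T) :=
  w.map Sum.inr ++ B.toList.map Sum.inl

theorem termPrefix_rlForm (w : List T) (B : Option N) : termPrefix (rlForm w B) = w := by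
  induction w with
  | nil => cases B <;> simp [rlForm, termPrefix]
  | cons a w ih => simpa [rlForm, termPrefix] using ih

theorem rlForm_eq_append_inl_cons {w : List T} {B : Option N} {x y : List (N ⊕ T)} {A : N}
    (h : rlForm w B = x ++ Sum.inl A :: y) : B = some A ∧ x = w.map Sum.inr ∧ y = [] := by
  induction w generalizing x with
  | nil =>
    cases B with
    | none => simp [rlForm] at h
    | some B => cases x <;> simp_all [rlForm]
  | cons a w ih =>
    cases x with
    | nil => simp [rlForm] at h
    | cons b x =>
      simp only [rlForm, List.map_cons, List.cons_append, List.cons.injEq] at h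
      obtain ⟨hB, hx, hy⟩ := ih h.2
      exact ⟨hB, by simp [← h.1, hx], hy⟩

theorem stepOf_rlForm_iff (G : OmegaPSG T) (π : DerivMode) {p : G.P} {A : G.N}
    (hA : G.lhs p = [A]) (w : List T) (B : Option G.N) (y : List (G.N ⊕ T)) :
    G.StepOf π p (rlForm w B) y ↔ B = some A ∧ y = w.map Sum.inr ++ G.rhs p := by
  constructor
  · intro h
    obtain ⟨u, v, h₁, h₂⟩ : G.Step p (rlForm w B) y := by
      cases π with
      | nl => exact h
      | l => obtain ⟨u, v, -, h⟩ := h; exact ⟨u, v, h⟩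
    obtain ⟨hB, rfl, rfl⟩ := rlForm_eq_append_inl_cons (A := A) (by simpa [hA] using h₁)
    exact ⟨hB, by simpa using h₂⟩
  · rintro ⟨rfl, rfl⟩
    have h : G.LStep p (rlForm w (some A)) (w.map Sum.inr ++ G.rhs p) :=
      ⟨w.map Sum.inr, [], by simp, by simp [rlForm, hA], by simp⟩
    cases π with
    | l => exact h
    | nl => obtain ⟨u, v, -, h⟩ := h; exact ⟨u, v, h⟩

theorem mem_lang_iff_isProductionRun (G : OmegaPSG T) (σ : AccSigma) (ρ : AccRho)
    (π : DerivMode) {w : G.P → List T} {lh : G.P → G.N} {nx : G.P → Option G.N}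
    (hl : ∀ p, G.lhs p = [lh p]) (hr : ∀ p, G.rhs p = rlForm (w p) (nx p)) (u : ℕ → T) :
    u ∈ G.Lang σ ρ π ↔
      ∃ d, IsProductionRun w lh nx G.start d u ∧ IsAccepting σ ρ G.acc d := by
  constructor
  · rintro ⟨s, d, h0, hs, hlen, hpre, hacc⟩
    have step : ∀ i B, s i = rlForm (concatUpTo w d i) B →
        s i = rlForm (concatUpTo w d i) (some (lh (d i))) ∧
        s (i + 1) = rlForm (concatUpTo w d (i + 1)) (nx (d i)) := by
      intro i B hB
      have h := hs i
      rw [hB, stepOf_rlForm_iff G π (hl _)] at h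
      refine ⟨by rw [hB, h.1], ?_⟩
      rw [h.2, hr]
      simp [rlForm, concatUpTo]
    have key : ∀ i, s i = rlForm (concatUpTo w d i) (some (lh (d i))) ∧
        s (i + 1) = rlForm (concatUpTo w d (i + 1)) (nx (d i)) := by
      intro i
      induction i with
      | zero => exact step 0 (some G.start) (by simp [h0, rlForm, concatUpTo])
      | succ i ih => exact step _ _ ih.2
    have inj : ∀ {v : List T} {B B' : Option G.N}, rlForm v B = rlForm v B' → B = B' := by
      intro v B B' h
      cases B <;> cases B' <;> simp_all [rlForm]
    have hp : ∀ i, termPrefix (s i) = concatUpTo w d i := fun i => by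
      rw [(key i).1, termPrefix_rlForm]
    simp only [hp] at hlen hpre
    refine ⟨d, ⟨?_, fun i => ?_, hlen, hpre⟩, hacc⟩
    · have := (key 0).1
      rw [h0] at this
      simpa [rlForm, concatUpTo, eq_comm] using this
    · exact inj ((key i).2.symm.trans (key (i + 1)).1)
  · rintro ⟨d, ⟨h0, hn, hlen, hpre⟩, hacc⟩
    refine ⟨fun i => rlForm (concatUpTo w d i) (some (lh (d i))), d, ?_, fun i => ?_, ?_, ?_,
      hacc⟩
    · simp [rlForm, concatUpTo, h0]
    · rw [stepOf_rlForm_iff G π (hl _), hr, hn]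
      simp [rlForm, concatUpTo]
    · simpa [termPrefix_rlForm] using hlen
    · simpa [termPrefix_rlForm] using hpre

theorem OmegaPSG.IsRLG.exists_components {G : OmegaPSG T} (hG : G.IsRLG) :
    ∃ (w : G.P → List T) (lh : G.P → G.N) (nx : G.P → Option G.N),
      (∀ p, G.lhs p = [lh p]) ∧ ∀ p, G.rhs p = rlForm (w p) (nx p) := by
  choose hlen w nx hr using hG
  choose lh hl using fun p => List.length_eq_one_iff.1 (hlen p)
  exact ⟨w, lh, nx, hl, hr⟩

end RightLinear

section FSAToGrammar

theorem sigmaSet_comp {P Q : Type} [Finite P] (σ : AccSigma) (f : P → Q) (d : ℕ → P) :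
    sigmaSet σ (fun i => f (d i)) = f '' sigmaSet σ d := by
  cases σ with
  | ran => exact Set.range_comp f d
  | inf =>
    ext q
    constructor
    · intro hq
      by_contra hcon
      have hev : ∀ p, ∃ n, f p = q → ∀ m, n ≤ m → d m ≠ p := by
        intro p
        by_contra! h
        exact hcon ⟨p, fun n => (h n).2, (h 0).1⟩
      choose n hn using hev
      obtain ⟨M, hM⟩ := (Set.finite_range n).bddAbove
      obtain ⟨m, hm, hfm⟩ := hq M
      exact hn (d m) hfm m ((hM ⟨d m, rfl⟩).trans hm) rfl
    · rintro ⟨p, hp, rfl⟩ n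
      obtain ⟨m, hm, rfl⟩ := hp n
      exact ⟨m, hm, rfl⟩

/-- designated sets on `P` that test the image of a sequence under `f` against `𝓕`. -/
def pullbackAcc {P Q : Type} (f : P → Q) (ρ : AccRho) (𝓕 : Set (Set Q)) : Set (Set P) :=
  match ρ with
  | .eq => {X | f '' X ∈ 𝓕}
  | _ => {X | ∃ F ∈ 𝓕, X = f ⁻¹' F}

theorem isAccepting_pullbackAcc {P Q : Type} [Finite P] (σ : AccSigma) (ρ : AccRho)
    (f : P → Q) (𝓕 : Set (Set Q)) (d : ℕ → P) :
    IsAccepting σ ρ (pullbackAcc f ρ 𝓕) d ↔ IsAccepting σ ρ 𝓕 (fun i => f (d i)) := by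
  unfold IsAccepting
  rw [sigmaSet_comp σ f d]
  cases ρ with
  | cap =>
    constructor
    · rintro ⟨_, ⟨F, hF, rfl⟩, h⟩
      exact ⟨F, hF, Set.image_inter_nonempty_iff.2 h⟩
    · rintro ⟨F, hF, h⟩
      exact ⟨_, ⟨F, hF, rfl⟩, Set.image_inter_nonempty_iff.1 h⟩
  | sub =>
    constructor
    · rintro ⟨_, ⟨F, hF, rfl⟩, h⟩
      exact ⟨F, hF, Set.image_subset_iff.2 h⟩
    · rintro ⟨F, hF, h⟩
      exact ⟨_, ⟨F, hF, rfl⟩, Set.image_subset_iff.1 h⟩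
  | eq =>
    constructor
    · rintro ⟨X, hX, h⟩
      exact ⟨_, hX, congrArg (f '' ·) h⟩
    · rintro ⟨F, hF, h⟩
      refine ⟨_, ?_, rfl⟩
      change f '' _ ∈ 𝓕
      rwa [show f '' sigmaSet σ d = F from h]

variable {T : Type} [Fintype T]

/-- the transitions of a finite state ω-automaton. -/
abbrev OmegaFSA.Edge (A : OmegaFSA T) : Type :=
  {e : A.Q × Option T × A.Q // A.trans e.1 e.2.1 e.2.2}

theorem OmegaFSA.finite_edge (A : OmegaFSA T) : Finite A.Edge := by
  have := A.fintypeQ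
  infer_instance

/-- the right linear ω-grammar with one production for each transition of `A`. -/
noncomputable def OmegaFSA.toGrammar (A : OmegaFSA T) (ρ : AccRho) : OmegaPSG T where
  N := A.Q
  fintypeN := A.fintypeQ
  P := A.Edge
  fintypeP := haveI := A.finite_edge; Fintype.ofFinite _
  lhs e := [e.1.1]
  lhs_ne _ := by simp
  rhs e := rlForm e.1.2.1.toList (some e.1.2.2)
  start := A.init
  acc := pullbackAcc (fun e : A.Edge => e.1.1) ρ A.acc

theorem OmegaFSA.toGrammar_isRLG (A : OmegaFSA T) (ρ : AccRho) : (A.toGrammar ρ).IsRLG :=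
  fun e => ⟨rfl, e.1.2.1.toList, some e.1.2.2, rfl⟩

theorem OmegaFSA.lang_toGrammar (A : OmegaFSA T) (σ : AccSigma) (ρ : AccRho)
    (π : DerivMode) : (A.toGrammar ρ).Lang σ ρ π = A.Lang σ ρ := by
  have := A.finite_edge
  ext u
  rw [mem_lang_iff_isProductionRun (A.toGrammar ρ) σ ρ π
    (w := fun e : A.Edge => e.1.2.1.toList) (lh := fun e : A.Edge => e.1.1)
    (nx := fun e : A.Edge => some e.1.2.2) (fun _ => rfl) (fun _ => rfl)]
  have hconcat : ∀ d : ℕ → A.Edge,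
      ConcatsTo (fun e : A.Edge => e.1.2.1.toList) d u ↔ Spells (fun i => (d i).1.2.1) u := by
    intro d
    simp only [spells_iff_concatsTo, ConcatsTo,
      concatUpTo_comp Option.toList (fun e : A.Edge => e.1.2.1) d]
  have hacc : ∀ d : ℕ → A.Edge, IsAccepting σ ρ (A.toGrammar ρ).acc d ↔
      IsAccepting σ ρ A.acc (fun i => (d i).1.1) := fun d =>
    isAccepting_pullbackAcc σ ρ (fun e : A.Edge => e.1.1) A.acc d
  constructor
  · rintro ⟨d, ⟨h0, hn, hc⟩, ha⟩
    refine ⟨fun i => (d i).1.1, fun i => (d i).1.2.1, h0, fun i => ?_, (hconcat d).1 hc,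
      (hacc d).1 ha⟩
    have := (d i).2
    rwa [Option.some.inj (hn i)] at this
  · rintro ⟨r, b, h0, ht, hsp, ha⟩
    exact ⟨fun i => ⟨(r i, b i, r (i + 1)), ht i⟩, ⟨h0, fun _ => rfl, (hconcat _).2 hsp⟩,
      (hacc _).2 ha⟩

end FSAToGrammar

section Blocks

variable {P T : Type} {w : P → List T} {d : ℕ → P}

/-- the time at which the `i`-th block starts when the block of `p` lasts `|w p| + 1` steps. -/
def blockStart (w : P → List T) (d : ℕ → P) : ℕ → ℕ
  | 0 => 0
  | i + 1 => blockStart w d i + (w (d i)).length + 1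

/-- at each time, `x` shows the current block and the offset within that block. -/
def Tracks (w : P → List T) (d : ℕ → P) (x : ℕ → P × ℕ) : Prop :=
  ∀ i j, j ≤ (w (d i)).length → x (blockStart w d i + j) = (d i, j)

theorem blockStart_strictMono : StrictMono (blockStart w d) :=
  strictMono_nat_of_lt_succ fun i => by simp only [blockStart]; omega

theorem exists_eq_blockStart_add (w : P → List T) (d : ℕ → P) (t : ℕ) :
    ∃ i j, j ≤ (w (d i)).length ∧ t = blockStart w d i + j := by
  induction t with
  | zero => exact ⟨0, 0, Nat.zero_le _, rfl⟩
  | succ t ih =>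
    obtain ⟨i, j, hj, rfl⟩ := ih
    rcases hj.lt_or_eq with h | h
    · exact ⟨i, j + 1, h, rfl⟩
    · exact ⟨i + 1, 0, Nat.zero_le _, by simp only [blockStart]; omega⟩

theorem blockStart_add_lt {i i' j : ℕ} (hj : j ≤ (w (d i)).length) (h : i < i') :
    blockStart w d i + j < blockStart w d i' := by
  have := (blockStart_strictMono (w := w) (d := d)).monotone (Nat.succ_le_of_lt h)
  simp only [blockStart] at this
  omega

theorem blockStart_add_inj {i i' j j' : ℕ} (hj : j ≤ (w (d i)).length)
    (hj' : j' ≤ (w (d i')).length) (h : blockStart w d i + j = blockStart w d i' + j') :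
    i = i' ∧ j = j' := by
  rcases lt_trichotomy i i' with hi | rfl | hi
  · have := blockStart_add_lt hj hi; omega
  · exact ⟨rfl, by omega⟩
  · have := blockStart_add_lt hj' hi; omega

theorem exists_tracks (w : P → List T) (d : ℕ → P) :
    ∃ x, Tracks w d x := by
  choose I J hJ ht using exists_eq_blockStart_add w d
  refine ⟨fun t => (d (I t), J t), fun i j hj => ?_⟩
  obtain ⟨h₁, h₂⟩ := blockStart_add_inj hj (hJ _) (ht (blockStart w d i + j))
  simp only [← h₁, ← h₂]

theorem Tracks.exists_index {x : ℕ → P × ℕ} (h : Tracks w d x) (t : ℕ) :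
    ∃ i j, j ≤ (w (d i)).length ∧ t = blockStart w d i + j ∧ x t = (d i, j) := by
  obtain ⟨i, j, hj, rfl⟩ := exists_eq_blockStart_add w d t
  exact ⟨i, j, hj, rfl, h i j hj⟩

theorem Tracks.snd_le {x : ℕ → P × ℕ} (h : Tracks w d x) (t : ℕ) :
    (x t).2 ≤ (w (x t).1).length := by
  obtain ⟨i, j, hj, -, hx⟩ := h.exists_index t
  rwa [hx]

theorem Tracks.blockStart_succ {x : ℕ → P × ℕ} (h : Tracks w d x) (i : ℕ) :
    x (blockStart w d i + (w (d i)).length + 1) = (d (i + 1), 0) :=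
  h (i + 1) 0 (Nat.zero_le _)

theorem Tracks.concatUpTo_toList {x : ℕ → P × ℕ} (h : Tracks w d x) {b : ℕ → Option T}
    (h0 : b 0 = none) (hb : ∀ t, b (t + 1) = (w (x t).1)[(x t).2]?) {i j : ℕ}
    (hj : j ≤ (w (d i)).length) :
    concatUpTo Option.toList b (blockStart w d i + j + 1) =
      concatUpTo w d i ++ (w (d i)).take j := by
  have step : ∀ i, concatUpTo Option.toList b (blockStart w d i + 1) = concatUpTo w d i →
      ∀ j ≤ (w (d i)).length, concatUpTo Option.toList b (blockStart w d i + j + 1) =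
        concatUpTo w d i ++ (w (d i)).take j := by
    intro i hi j
    induction j with
    | zero => intro _; simpa using hi
    | succ j ih =>
      intro hj
      rw [concatUpTo, ← add_assoc, ih (by omega), hb, h i j (by omega), List.take_add_one,
        List.append_assoc]
  refine step i ?_ j hj
  clear hj
  induction i with
  | zero => simp [concatUpTo, blockStart, h0]
  | succ i ih =>
    rw [concatUpTo, blockStart, step i ih _ le_rfl, hb, h i _ le_rfl]
    simp [concatUpTo]

theorem Tracks.spells_iff {x : ℕ → P × ℕ} (h : Tracks w d x) {b : ℕ → Option T}
    (h0 : b 0 = none) (hb : ∀ t, b (t + 1) = (w (x t).1)[(x t).2]?) (u : ℕ → T) :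
    Spells b u ↔ ConcatsTo w d u := by
  have hfwd : ∀ i, concatUpTo Option.toList b (blockStart w d i + 1) = concatUpTo w d i :=
    fun i => by simpa using h.concatUpTo_toList h0 hb (i := i) (Nat.zero_le _)
  have hbwd : ∀ t, ∃ i, concatUpTo Option.toList b t <+: concatUpTo w d i := by
    rintro (_ | t)
    · exact ⟨0, List.prefix_rfl⟩
    · obtain ⟨i, j, hj, rfl⟩ := exists_eq_blockStart_add w d t
      refine ⟨i + 1, ?_⟩
      rw [h.concatUpTo_toList h0 hb hj, concatUpTo]
      exact (List.prefix_append_right_inj _).2 (List.take_prefix _ _)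
  rw [spells_iff_concatsTo]
  constructor
  · rintro ⟨h₁, h₂⟩
    refine ⟨fun n => ?_, fun i => hfwd i ▸ h₂ _⟩
    obtain ⟨t, ht⟩ := h₁ n
    obtain ⟨i, hi⟩ := hbwd t
    exact ⟨i, ht.trans hi.length_le⟩
  · rintro ⟨h₁, h₂⟩
    refine ⟨fun n => ?_, fun t => ?_⟩
    · obtain ⟨i, hi⟩ := h₁ n
      exact ⟨blockStart w d i + 1, by rwa [hfwd]⟩
    · obtain ⟨i, hi⟩ := hbwd t
      exact (h₂ i).of_isPrefix hi

end Blocks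

section GrammarToFSA

variable {T N P : Type} (w : P → List T) (lh : P → N) (nx : P → Option N) (S : N)

/-- a production together with the number of letters of its word already read. -/
abbrev BlockState : Type := {x : P × ℕ // x.2 ≤ (w x.1).length}

theorem finite_blockState [Finite P] : Finite (BlockState w) :=
  Finite.of_surjective
    (fun y : Σ p : P, Fin ((w p).length + 1) =>
      (⟨(y.1, y.2), Nat.lt_succ_iff.1 y.2.2⟩ : BlockState w))
    fun x => ⟨⟨x.1.1, x.1.2, Nat.lt_succ_iff.2 x.2⟩, rfl⟩

/-- either the next letter of the current production is read, or the word of the current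
production is exhausted and a production for the nonterminal on its right is entered. -/
def BlockStep (x y : P × ℕ) : Prop :=
  (y.1 = x.1 ∧ y.2 = x.2 + 1) ∨
  (x.2 = (w x.1).length ∧ y.2 = 0 ∧ nx x.1 = some (lh y.1))

/-- transition relation of the automaton simulating the productions letter by letter;
`none` is the initial state. -/
def BlockTrans : Option (BlockState w) → Option T → Option (BlockState w) → Prop
  | none, b, some y => b = none ∧ y.1.2 = 0 ∧ lh y.1.1 = S
  | some x, b, some y => b = (w x.1.1)[x.1.2]? ∧ BlockStep w lh nx x.1 y.1
  | _, _, none => False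

/-- the states whose production lies in `F`, and the initial state if `c` holds. -/
def liftSet (c : Prop) (F : Set P) : Set (Option (BlockState w)) :=
  {q | match q with
    | none => c
    | some x => x.1.1 ∈ F}

/-- the finite state ω-automaton simulating right linear productions letter by letter. -/
noncomputable def blockFSA [Finite P] (σ : AccSigma) (ρ : AccRho) (𝓕 : Set (Set P)) :
    OmegaFSA T where
  Q := Option (BlockState w)
  fintypeQ := haveI := finite_blockState w; Fintype.ofFinite _
  init := none
  trans := BlockTrans w lh nx S
  acc := {X | ∃ F ∈ 𝓕, X = liftSet w (σ = .ran ∧ ρ ≠ .cap) F}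

variable {w lh nx S}

theorem liftSet_subset_liftSet_iff {c : Prop} {D F : Set P} :
    liftSet w c D ⊆ liftSet w c F ↔ D ⊆ F := by
  constructor
  · intro h p hp
    exact @h (some ⟨(p, 0), Nat.zero_le _⟩) hp
  · rintro h (_ | x) hx
    · exact hx
    · exact h hx

theorem rhoRel_liftSet_iff (σ : AccSigma) (ρ : AccRho) (D F : Set P) :
    rhoRel ρ (liftSet w (σ = .ran) D) (liftSet w (σ = .ran ∧ ρ ≠ .cap) F) ↔
      rhoRel ρ D F := by
  cases ρ with
  | cap =>
    constructor
    · rintro ⟨_ | x, h₁, h₂⟩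
      · exact absurd rfl h₂.2
      · exact ⟨_, h₁, h₂⟩
    · rintro ⟨p, h₁, h₂⟩
      exact ⟨some ⟨(p, 0), Nat.zero_le _⟩, h₁, h₂⟩
  | sub => simpa [rhoRel] using liftSet_subset_liftSet_iff
  | eq => simp [rhoRel, Set.Subset.antisymm_iff, liftSet_subset_liftSet_iff]

theorem sigmaSet_eq_liftSet (σ : AccSigma) {d : ℕ → P} {x : ℕ → P × ℕ} (h : Tracks w d x)
    {r : ℕ → Option (BlockState w)} (h0 : r 0 = none)
    (hr : ∀ t, r (t + 1) = some ⟨x t, h.snd_le t⟩) :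
    sigmaSet σ r = liftSet w (σ = .ran) (sigmaSet σ d) := by
  have hvisit : ∀ i (y : BlockState w), d i = y.1.1 →
      r (blockStart w d i + y.1.2 + 1) = some y := by
    intro i y hy
    rw [hr]
    congr 1
    apply Subtype.ext
    change x _ = y.1
    rw [h i y.1.2 (hy ▸ y.2), hy]
  cases σ with
  | ran =>
    ext (_ | y)
    · simpa [sigmaSet, liftSet] using ⟨0, h0⟩
    · constructor
      · rintro ⟨_ | t, ht⟩
        · simp [h0] at ht
        · obtain ⟨i, j, -, -, hx⟩ := h.exists_index t
          rw [hr] at ht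
          cases ht
          exact ⟨i, by simp [hx]⟩
      · rintro ⟨i, hi⟩
        exact ⟨_, hvisit i y hi⟩
  | inf =>
    ext (_ | y)
    · simp only [sigmaSet, liftSet, Set.mem_ofPred_eq, reduceCtorEq, iff_false, not_forall]
      refine ⟨1, ?_⟩
      rintro ⟨_ | t, h₁, ht⟩
      · omega
      · simp [hr] at ht
    · constructor
      · intro hy n
        obtain ⟨_ | t, htn, ht⟩ := hy (blockStart w d n + 1)
        · omega
        · obtain ⟨i, j, hj, hti, hx⟩ := h.exists_index t
          rw [hr] at ht
          cases ht
          refine ⟨i, ?_, by simp [hx]⟩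
          by_contra! hlt
          have := blockStart_add_lt hj hlt
          omega
      · intro hy n
        obtain ⟨i, hi, hdi⟩ := hy n
        refine ⟨_, ?_, hvisit i y hdi⟩
        have := (blockStart_strictMono (w := w) (d := d)).id_le i
        simp only [id] at this
        omega

theorem Tracks.blockStep {d : ℕ → P} {x : ℕ → P × ℕ} (h : Tracks w d x)
    (hn : ∀ i, nx (d i) = some (lh (d (i + 1)))) (t : ℕ) :
    BlockStep w lh nx (x t) (x (t + 1)) := by
  obtain ⟨i, j, hj, rfl, hx⟩ := h.exists_index t
  rw [hx]
  rcases hj.lt_or_eq with hlt | rfl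
  · rw [add_assoc, h i (j + 1) hlt]
    exact Or.inl ⟨rfl, rfl⟩
  · rw [h.blockStart_succ]
    exact Or.inr ⟨rfl, rfl, hn i⟩

theorem Tracks.nx_eq {d : ℕ → P} {x : ℕ → P × ℕ} (h : Tracks w d x)
    (hs : ∀ t, BlockStep w lh nx (x t) (x (t + 1))) (i : ℕ) :
    nx (d i) = some (lh (d (i + 1))) := by
  have := hs (blockStart w d i + (w (d i)).length)
  rw [h.blockStart_succ, h i _ le_rfl] at this
  rcases this with ⟨-, h'⟩ | ⟨-, -, h'⟩
  · simp at h'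
  · exact h'

theorem exists_tracks_of_blockStep {x : ℕ → P × ℕ} (h0 : (x 0).2 = 0)
    (hle : ∀ t, (x t).2 ≤ (w (x t).1).length)
    (hs : ∀ t, BlockStep w lh nx (x t) (x (t + 1))) : ∃ d, Tracks w d x := by
  let τ : ℕ → ℕ := fun i => Nat.rec 0 (fun _ t => t + (w (x t).1).length + 1) i
  have hτ : ∀ i, blockStart w (fun i => (x (τ i)).1) i = τ i := by
    intro i
    induction i with
    | zero => rfl
    | succ i ih => rw [blockStart, ih]
  have hblock : ∀ i, (x (τ i)).2 = 0 → ∀ j ≤ (w (x (τ i)).1).length,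
      x (τ i + j) = ((x (τ i)).1, j) := by
    intro i hi j
    induction j with
    | zero => intro _; exact Prod.ext rfl hi
    | succ j ih =>
      intro hj
      have hstep := hs (τ i + j)
      rw [ih (by omega)] at hstep
      rcases hstep with ⟨h₁, h₂⟩ | ⟨h₁, -⟩
      · exact Prod.ext h₁ h₂
      · simp only at h₁
        omega
  have hzero : ∀ i, (x (τ i)).2 = 0 := by
    intro i
    induction i with
    | zero => exact h0
    | succ i ih =>
      have hstep := hs (τ i + (w (x (τ i)).1).length)
      have hbound := hle (τ i + (w (x (τ i)).1).length + 1)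
      rw [hblock i ih _ le_rfl] at hstep
      rcases hstep with ⟨h₁, h₂⟩ | ⟨-, h₂, -⟩
      · rw [h₁, h₂] at hbound
        simp at hbound
      · exact h₂
  refine ⟨fun i => (x (τ i)).1, fun i j hj => ?_⟩
  rw [hτ]
  exact hblock i (hzero i) j hj

theorem mem_lang_blockFSA_iff [Finite P] (σ : AccSigma) (ρ : AccRho) (𝓕 : Set (Set P))
    (u : ℕ → T) :
    u ∈ (blockFSA w lh nx S σ ρ 𝓕).Lang σ ρ ↔
      ∃ d, IsProductionRun w lh nx S d u ∧ IsAccepting σ ρ 𝓕 d := by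
  have hacc : ∀ {d : ℕ → P} {x : ℕ → P × ℕ} (h : Tracks w d x)
      {r : ℕ → Option (BlockState w)}, r 0 = none →
      (∀ t, r (t + 1) = some ⟨x t, h.snd_le t⟩) →
      (IsAccepting σ ρ (blockFSA w lh nx S σ ρ 𝓕).acc r ↔ IsAccepting σ ρ 𝓕 d) := by
    intro d x h r h0 hr
    change (∃ F ∈ {X | ∃ F ∈ 𝓕, X = liftSet w (σ = .ran ∧ ρ ≠ .cap) F},
      rhoRel ρ (sigmaSet σ r) F) ↔ ∃ F ∈ 𝓕, rhoRel ρ (sigmaSet σ d) F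
    rw [sigmaSet_eq_liftSet σ h h0 hr]
    constructor
    · rintro ⟨_, ⟨F, hF, rfl⟩, hF'⟩
      exact ⟨F, hF, (rhoRel_liftSet_iff σ ρ _ _).1 hF'⟩
    · rintro ⟨F, hF, hF'⟩
      exact ⟨_, ⟨F, hF, rfl⟩, (rhoRel_liftSet_iff σ ρ _ _).2 hF'⟩
  constructor
  · rintro ⟨r, b, h0, ht, hsp, ha⟩
    change ℕ → Option (BlockState w) at r
    change r 0 = none at h0
    change ∀ t, BlockTrans w lh nx S (r t) (b t) (r (t + 1)) at ht
    have hsome : ∀ t, ∃ y : BlockState w, r (t + 1) = some y := by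
      intro t
      have := ht t
      cases hy : r (t + 1) with
      | some y => exact ⟨y, rfl⟩
      | none => cases hq : r t <;> simp [hy, hq, BlockTrans] at this
    choose y hy using hsome
    have hstart := ht 0
    rw [h0, hy] at hstart
    obtain ⟨hb0, hy0, hS⟩ := hstart
    have hstep : ∀ t, b (t + 1) = (w (y t).1.1)[(y t).1.2]? ∧
        BlockStep w lh nx (y t).1 (y (t + 1)).1 := by
      intro t
      have := ht (t + 1)
      rwa [hy, hy] at this
    obtain ⟨d, hd⟩ := exists_tracks_of_blockStep (x := fun t => (y t).1) hy0
      (fun t => (y t).2) (fun t => (hstep t).2)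
    refine ⟨d, ⟨?_, hd.nx_eq fun t => (hstep t).2,
      (hd.spells_iff hb0 (fun t => (hstep t).1) u).1 hsp⟩, (hacc hd h0 hy).1 ha⟩
    have := hd 0 0 (Nat.zero_le _)
    simp only [blockStart, add_zero] at this
    rwa [this] at hS
  · rintro ⟨d, ⟨hS, hn, hc⟩, ha⟩
    obtain ⟨x, hx⟩ := exists_tracks w d
    let r : ℕ → Option (BlockState w) := fun t => t.casesOn none fun t => some ⟨x t, hx.snd_le t⟩
    let b : ℕ → Option T := fun t => t.casesOn none fun t => (w (x t).1)[(x t).2]?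
    refine ⟨r, b, rfl, ?_, (hx.spells_iff rfl (fun _ => rfl) u).2 hc,
      (hacc hx rfl fun _ => rfl).2 ha⟩
    rintro (_ | t)
    · have := hx 0 0 (Nat.zero_le _)
      simp only [blockStart, add_zero] at this
      exact ⟨rfl, by simp [this], by simpa [this] using hS⟩
    · exact ⟨rfl, hx.blockStep hn t⟩

end GrammarToFSA

theorem OmegaPSG.IsRLG.lang_nl_eq_lang_l {T : Type} {G : OmegaPSG T} (hG : G.IsRLG)
    (σ : AccSigma) (ρ : AccRho) : G.Lang σ ρ .nl = G.Lang σ ρ .l := by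
  obtain ⟨w, lh, nx, hl, hr⟩ := hG.exists_components
  ext u
  rw [mem_lang_iff_isProductionRun G σ ρ _ hl hr, mem_lang_iff_isProductionRun G σ ρ _ hl hr]

theorem OmegaPSG.IsRLG.exists_fsa_lang_eq {T : Type} {G : OmegaPSG T} (hG : G.IsRLG)
    (σ : AccSigma) (ρ : AccRho) (π : DerivMode) :
    ∃ A : OmegaFSA T, G.Lang σ ρ π = A.Lang σ ρ := by
  obtain ⟨w, lh, nx, hl, hr⟩ := hG.exists_components
  have := G.fintypeP
  refine ⟨blockFSA w lh nx G.start σ ρ G.acc, ?_⟩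
  ext u
  rw [mem_lang_iff_isProductionRun G σ ρ π hl hr, mem_lang_blockFSA_iff]

end OmegaFormal

/-- Theorem: 𝓛_{σ,ρ,nl}(ω-RLG) = 𝓛_{σ,ρ,l}(ω-RLG) = 𝓛_{σ,ρ}(ω-FSA)
for every acceptance mode (σ,ρ). -/
theorem rlg_nl_eq_l_eq_fsa (T : Type) [Fintype T] (σ : AccSigma) (ρ : AccRho) :
    GLang T OmegaPSG.IsRLG σ ρ DerivMode.nl = GLang T OmegaPSG.IsRLG σ ρ DerivMode.l ∧
    GLang T OmegaPSG.IsRLG σ ρ DerivMode.l = FSALang T σ ρ := by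
  constructor
  · ext L
    constructor
    · rintro ⟨G, hG, rfl⟩
      exact ⟨G, hG, hG.lang_nl_eq_lang_l σ ρ⟩
    · rintro ⟨G, hG, rfl⟩
      exact ⟨G, hG, (hG.lang_nl_eq_lang_l σ ρ).symm⟩
  · ext L
    constructor
    · rintro ⟨G, hG, rfl⟩
      exact hG.exists_fsa_lang_eq σ ρ .l
    · rintro ⟨A, rfl⟩
      exact ⟨A.toGrammar ρ, A.toGrammar_isRLG ρ, (A.lang_toGrammar σ ρ .l).symm⟩
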